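/- Let n ≥ 5 and let T and T′ be positive-weighted trees, each with leaf set [n] and with no vertices of degree 2. If D_{i,j,k}(T) = D_{i,j,k}(T′) for every 3-subset {i,j,k} of [n], then there is an isomorphism of weighted trees from T to T′, i.e., a graph isomorphism preserving the lengths of corresponding edges and fixing the labels of the leaves. -/

import Mathlib

/-- A weighted tree whose leaves are labeled bijectively by `Fin n`. -/
structure WeightedTree (n : ℕ) where
  V : Type
  [fintypeV : Fintype V]
  [decEqV : DecidableEq V]
  G : SimpleGraph V
  [decAdj : DecidableRel G.Adj]
  isTree : G.IsTree
  w : Sym2 V → ℝ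
  leaf : Fin n → V
  leaf_inj : Function.Injective leaf
  leaf_iff : ∀ v : V, (∃ i, leaf i = v) ↔ G.degree v ≤ 1

attribute [instance] WeightedTree.fintypeV WeightedTree.decEqV WeightedTree.decAdj

namespace WeightedTree

variable {n : ℕ}

/-- The unique path between two vertices of a tree. -/
noncomputable def treePath (T : WeightedTree n) (u v : T.V) : T.G.Walk u v :=
  (T.isTree.existsUnique_path u v).choose

/-- The sum of the weights of the edges on the path from `u` to `v`. -/
noncomputable def pathWeight (T : WeightedTree n) (u v : T.V) : ℝ :=
  ((T.treePath u v).edges.map T.w).sum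

open Classical in
/-- The total weight of the minimal subtree spanning the leaves indexed by `S`:
the sum of the weights of the edges lying on a path between two leaves of `S`. -/
noncomputable def D (T : WeightedTree n) (S : Finset (Fin n)) : ℝ :=
  ∑ e ∈ T.G.edgeFinset.filter
      (fun e => ∃ i ∈ S, ∃ j ∈ S, e ∈ (T.treePath (T.leaf i) (T.leaf j)).edges),
    T.w e

/-- All edge weights are positive. -/
def PosWeights (T : WeightedTree n) : Prop := ∀ e ∈ T.G.edgeSet, 0 < T.w e

/-- Two leaves are neighbours (form a cherry) if the path between them contains
exactly one vertex of degree at least 3. -/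
def Neighbours (T : WeightedTree n) (a b : Fin n) : Prop :=
  ∃! z : T.V, z ∈ (T.treePath (T.leaf a) (T.leaf b)).support ∧ 3 ≤ T.G.degree z

end WeightedTree

open WeightedTree

/-- An isomorphism of weighted trees: a graph isomorphism which preserves the
lengths of corresponding edges and fixes the labels of the leaves. -/
def WeightedTreeIso {n : ℕ} (T T' : WeightedTree n) : Prop :=
  ∃ φ : T.G ≃g T'.G,
    (∀ e ∈ T.G.edgeSet, T'.w (Sym2.map φ e) = T.w e) ∧
    ∀ i : Fin n, φ (T.leaf i) = T'.leaf i

namespace WeightedTree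

variable {n : ℕ} (T : WeightedTree n)

lemma treePath_isPath (u v : T.V) : (T.treePath u v).IsPath :=
  (T.isTree.existsUnique_path u v).choose_spec.1

variable {T} in
lemma eq_treePath {u v : T.V} {p : T.G.Walk u v} (hp : p.IsPath) : p = T.treePath u v :=
  (T.isTree.existsUnique_path u v).unique hp (T.treePath_isPath u v)

lemma treePath_reverse (u v : T.V) : (T.treePath u v).reverse = T.treePath v u :=
  eq_treePath (T.treePath_isPath u v).reverse

lemma treePath_self (u : T.V) : T.treePath u u = .nil :=
  (eq_treePath SimpleGraph.Walk.IsPath.nil).symm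

variable {T} in
lemma treePath_of_adj {u v : T.V} (h : T.G.Adj u v) : T.treePath u v = h.toWalk :=
  (eq_treePath (SimpleGraph.Walk.IsPath.of_adj h)).symm

/-- `m` lies on the path from `u` to `v`. -/
def Btw (u m v : T.V) : Prop := m ∈ (T.treePath u v).support

/-- The edges of the path from `u` to `v`. -/
noncomputable def pathEdges (u v : T.V) : Finset (Sym2 T.V) := (T.treePath u v).edges.toFinset

lemma pathWeight_eq_sum (u v : T.V) : T.pathWeight u v = ∑ e ∈ T.pathEdges u v, T.w e :=
  (List.sum_toFinset T.w (T.treePath_isPath u v).isTrail.edges_nodup).symm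

variable {T}

lemma mem_edgeSet_of_mem_pathEdges {u v : T.V} {e : Sym2 T.V} (he : e ∈ T.pathEdges u v) :
    e ∈ T.G.edgeSet :=
  (T.treePath u v).edges_subset_edgeSet (List.mem_toFinset.1 he)

lemma pathEdges_comm (u v : T.V) : T.pathEdges u v = T.pathEdges v u := by
  ext e
  simp [pathEdges, ← T.treePath_reverse v u]

lemma pathEdges_self (u : T.V) : T.pathEdges u u = ∅ := by
  simp [pathEdges, treePath_self]

lemma pathEdges_subset (u m v : T.V) :
    T.pathEdges u v ⊆ T.pathEdges u m ∪ T.pathEdges m v := by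
  intro e he
  rw [pathEdges, List.mem_toFinset,
    ← eq_treePath (((T.treePath u m).append (T.treePath m v)).bypass_isPath)] at he
  simpa [pathEdges] using SimpleGraph.Walk.edges_bypass_subset_edges _ he

lemma pathWeight_comm (u v : T.V) : T.pathWeight u v = T.pathWeight v u := by
  rw [pathWeight_eq_sum, pathWeight_eq_sum, pathEdges_comm]

lemma pathWeight_self (u : T.V) : T.pathWeight u u = 0 := by
  rw [pathWeight_eq_sum, pathEdges_self, Finset.sum_empty]

lemma pathWeight_of_adj {u v : T.V} (h : T.G.Adj u v) : T.pathWeight u v = T.w s(u, v) := by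
  simp [pathWeight, treePath_of_adj h]

namespace Btw

lemma symm {u m v : T.V} (h : T.Btw u m v) : T.Btw v m u := by
  rw [Btw, ← T.treePath_reverse u v, SimpleGraph.Walk.support_reverse]
  exact List.mem_reverse.2 h

lemma left (u v : T.V) : T.Btw u u v := SimpleGraph.Walk.start_mem_support _

lemma right (u v : T.V) : T.Btw u v v := SimpleGraph.Walk.end_mem_support _

lemma treePath_eq {u m v : T.V} (h : T.Btw u m v) :
    T.treePath u v = (T.treePath u m).append (T.treePath m v) := by
  rw [← eq_treePath ((T.treePath_isPath u v).takeUntil h),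
    ← eq_treePath ((T.treePath_isPath u v).dropUntil h)]
  exact ((T.treePath u v).take_spec h).symm

lemma pathEdges_eq {u m v : T.V} (h : T.Btw u m v) :
    T.pathEdges u v = T.pathEdges u m ∪ T.pathEdges m v := by
  simp [pathEdges, h.treePath_eq]

lemma disjoint {u m v : T.V} (h : T.Btw u m v) :
    Disjoint (T.pathEdges u m) (T.pathEdges m v) := by
  have hn := (T.treePath_isPath u v).isTrail.edges_nodup
  rw [h.treePath_eq, SimpleGraph.Walk.edges_append] at hn
  rw [Finset.disjoint_left]
  intro e he he'
  exact (List.disjoint_of_nodup_append hn) (List.mem_toFinset.1 he) (List.mem_toFinset.1 he')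

lemma pathWeight_add {u m v : T.V} (h : T.Btw u m v) :
    T.pathWeight u m + T.pathWeight m v = T.pathWeight u v := by
  simp [pathWeight, h.treePath_eq]

lemma trans {u m y v : T.V} (h : T.Btw u m v) (hy : T.Btw m y v) : T.Btw u y v := by
  rw [Btw, h.treePath_eq, SimpleGraph.Walk.mem_support_append_iff]
  exact .inr hy

lemma or {u m v : T.V} (h : T.Btw u m v) (x : T.V) : T.Btw u m x ∨ T.Btw x m v := by
  rw [Btw, ← eq_treePath (((T.treePath u x).append (T.treePath x v)).bypass_isPath)] at h
  exact (SimpleGraph.Walk.mem_support_append_iff _ _).1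
    (SimpleGraph.Walk.support_bypass_subset_support _ h)

lemma of_adj {u a b : T.V} (ha : T.G.Adj u a) (hb : T.G.Adj u b) (hab : a ≠ b) :
    T.Btw a u b := by
  have hp : (SimpleGraph.Walk.cons ha.symm hb.toWalk).IsPath := by
    simp [SimpleGraph.Walk.cons_isPath_iff, ha.ne', hab, hb.ne]
  rw [Btw, ← eq_treePath hp]
  simp

lemma exists_adj {u v : T.V} (h : u ≠ v) : ∃ y, T.G.Adj u y ∧ T.Btw u y v := by
  rw [show (∃ y, T.G.Adj u y ∧ T.Btw u y v) ↔
    ∃ y, T.G.Adj u y ∧ y ∈ (T.treePath u v).support from Iff.rfl]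
  cases T.treePath u v with
  | nil => exact absurd rfl h
  | cons ha p => exact ⟨_, ha, by simp⟩

end Btw

section Positive

variable (hT : T.PosWeights)
include hT

lemma pathWeight_nonneg (u v : T.V) : 0 ≤ T.pathWeight u v := by
  rw [pathWeight_eq_sum]
  exact Finset.sum_nonneg fun e he => (hT e (mem_edgeSet_of_mem_pathEdges he)).le

lemma pathWeight_pos {u v : T.V} (h : u ≠ v) : 0 < T.pathWeight u v := by
  obtain ⟨y, hy, hb⟩ := Btw.exists_adj h
  rw [← hb.pathWeight_add, pathWeight_of_adj hy]
  have h1 := hT s(u, y) hy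
  have h2 := pathWeight_nonneg hT y v
  linarith

lemma eq_of_pathWeight_eq_zero {u v : T.V} (h : T.pathWeight u v = 0) : u = v := by
  by_contra hne
  exact (pathWeight_pos hT hne).ne' h

lemma pathWeight_triangle (u m v : T.V) :
    T.pathWeight u v ≤ T.pathWeight u m + T.pathWeight m v := by
  simp only [pathWeight_eq_sum]
  have hw : ∀ a b : T.V, ∀ e ∈ T.pathEdges a b, 0 ≤ T.w e := fun a b e he =>
    (hT e (mem_edgeSet_of_mem_pathEdges he)).le
  calc _ ≤ ∑ e ∈ T.pathEdges u m ∪ T.pathEdges m v, T.w e :=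
        Finset.sum_le_sum_of_subset_of_nonneg (pathEdges_subset u m v) fun e he _ => by
          rcases Finset.mem_union.1 he with he | he <;> exact hw _ _ e he
    _ ≤ _ := by
        rw [← Finset.sum_union_inter]
        exact le_add_of_nonneg_right <|
          Finset.sum_nonneg fun e he => hw _ _ e (Finset.mem_inter.1 he).1

lemma Btw.antisymm {u a b : T.V} (h : T.Btw u a b) (h' : T.Btw u b a) : a = b := by
  have h1 := h.pathWeight_add
  have h2 := h'.pathWeight_add
  rw [pathWeight_comm b a] at h2
  exact eq_of_pathWeight_eq_zero hT (by linarith)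

/-- A vertex separating two of its neighbours separates what lies beyond them. -/
lemma Btw.of_adj_of_btw {m y z j k : T.V} (hy : T.G.Adj m y) (hz : T.G.Adj m z) (hyz : y ≠ z)
    (hj : T.Btw m y j) (hk : T.Btw m z k) : T.Btw j m k := by
  have h1 : T.Btw y m k := by
    rcases (Btw.of_adj hy hz hyz).or k with h | h
    · exact h
    · exact absurd (Btw.antisymm hT h hk.symm) hz.ne
  rcases h1.or j with h | h
  · exact absurd (Btw.antisymm hT hj.symm h.symm) hy.ne'
  · exact h

/-- `m` lies on the three paths connecting `u`, `v` and `x`. -/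
structure IsMedian (m u v x : T.V) : Prop where
  btw_fst_snd : T.Btw u m v
  btw_fst_thd : T.Btw u m x
  btw_snd_thd : T.Btw v m x

lemma exists_isMedian (u v x : T.V) : ∃ m, IsMedian m u v x := by
  classical
  obtain ⟨m, hm, hmax⟩ := Finset.exists_max_image
    (Finset.univ.filter fun m => T.Btw u m v ∧ T.Btw u m x) (T.pathWeight u)
    ⟨u, by simp [Btw.left]⟩
  simp only [Finset.mem_filter, Finset.mem_univ, true_and] at hm hmax
  obtain ⟨hv, hx⟩ := hm
  refine ⟨m, hv, hx, ?_⟩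
  rcases eq_or_ne m v with rfl | hmv
  · exact Btw.left _ _
  rcases eq_or_ne m x with rfl | hmx
  · exact Btw.right _ _
  obtain ⟨y, hy, hyv⟩ := Btw.exists_adj hmv
  obtain ⟨z, hz, hzx⟩ := Btw.exists_adj hmx
  refine Btw.of_adj_of_btw hT hy hz ?_ hyv hzx
  rintro rfl
  have hmax := hmax y ⟨hv.trans hyv, hx.trans hzx⟩
  have huy : T.Btw u m y := (hv.or y).resolve_right fun h =>
    hy.ne (Btw.antisymm hT h.symm hyv.symm)
  have h1 := huy.pathWeight_add
  have h2 := pathWeight_pos hT hy.ne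
  linarith

lemma btw_iff_pathWeight_add {u m v : T.V} :
    T.Btw u m v ↔ T.pathWeight u m + T.pathWeight m v = T.pathWeight u v := by
  refine ⟨Btw.pathWeight_add, fun h => ?_⟩
  obtain ⟨p, hp⟩ := exists_isMedian hT u v m
  have h1 := hp.btw_fst_snd.pathWeight_add
  have h2 := hp.btw_fst_thd.pathWeight_add
  have h3 := hp.btw_snd_thd.pathWeight_add
  rw [pathWeight_comm v p, pathWeight_comm v m] at h3
  obtain rfl : p = m := eq_of_pathWeight_eq_zero hT (by linarith)
  exact hp.btw_fst_snd

lemma adj_iff_forall_pathWeight {u v : T.V} :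
    T.G.Adj u v ↔ u ≠ v ∧ ∀ m, T.pathWeight u m + T.pathWeight m v = T.pathWeight u v →
      m = u ∨ m = v := by
  simp only [← btw_iff_pathWeight_add hT]
  constructor
  · refine fun h => ⟨h.ne, fun m hm => ?_⟩
    simpa [Btw, treePath_of_adj h] using hm
  · rintro ⟨hne, h⟩
    obtain ⟨y, hy, hyv⟩ := Btw.exists_adj hne
    rcases h y hyv with rfl | rfl
    · exact absurd rfl hy.ne
    · exact hy

end Positive

lemma IsMedian.pathWeight_fst {m u v x : T.V} (h : IsMedian m u v x) :
    T.pathWeight u m = (T.pathWeight u v + T.pathWeight u x - T.pathWeight v x) / 2 := by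
  have h1 := h.btw_fst_snd.pathWeight_add
  have h2 := h.btw_fst_thd.pathWeight_add
  have h3 := h.btw_snd_thd.pathWeight_add
  rw [pathWeight_comm v m] at h3
  linarith

lemma IsMedian.symm {m u v x : T.V} (h : IsMedian m u v x) : IsMedian m v u x :=
  ⟨h.1.symm, h.3, h.2⟩

lemma IsMedian.rotate {m u v x : T.V} (h : IsMedian m u v x) : IsMedian m x u v :=
  ⟨h.2.symm, h.3.symm, h.1⟩

lemma D_triple (hT : T.PosWeights) (i j k : Fin n) :
    T.D {i, j, k} = (T.pathWeight (T.leaf i) (T.leaf j) + T.pathWeight (T.leaf i) (T.leaf k) +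
      T.pathWeight (T.leaf j) (T.leaf k)) / 2 := by
  classical
  obtain ⟨m, hm⟩ := exists_isMedian hT (T.leaf i) (T.leaf j) (T.leaf k)
  have hS : T.G.edgeFinset.filter (fun e => ∃ a ∈ ({i, j, k} : Finset (Fin n)),
      ∃ b ∈ ({i, j, k} : Finset (Fin n)), e ∈ (T.treePath (T.leaf a) (T.leaf b)).edges) =
      T.pathEdges (T.leaf i) m ∪ T.pathEdges (T.leaf j) m ∪ T.pathEdges (T.leaf k) m := by
    ext e
    constructor
    · intro he
      obtain ⟨-, a, ha, b, hb, he⟩ := Finset.mem_filter.1 he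
      have he := pathEdges_subset _ m _ (List.mem_toFinset.2 he)
      rw [pathEdges_comm m] at he
      simp only [Finset.mem_insert, Finset.mem_singleton] at ha hb
      simp only [Finset.mem_union] at he ⊢
      rcases ha with rfl | rfl | rfl <;> rcases hb with rfl | rfl | rfl <;> tauto
    · intro he
      refine Finset.mem_filter.2 ⟨?_, ?_⟩
      · rw [SimpleGraph.mem_edgeFinset]
        simp only [Finset.mem_union] at he
        rcases he with (he | he) | he <;> exact mem_edgeSet_of_mem_pathEdges he
      · have key : ∀ a b, T.Btw (T.leaf a) m (T.leaf b) → e ∈ T.pathEdges (T.leaf a) m →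
            e ∈ (T.treePath (T.leaf a) (T.leaf b)).edges := fun a b h h' =>
          List.mem_toFinset.1 (h.pathEdges_eq ▸ Finset.mem_union_left _ h' :
            e ∈ T.pathEdges (T.leaf a) (T.leaf b))
        simp only [Finset.mem_union] at he
        rcases he with (he | he) | he
        · exact ⟨i, by simp, j, by simp, key i j hm.1 he⟩
        · exact ⟨j, by simp, k, by simp, key j k hm.3 he⟩
        · exact ⟨k, by simp, i, by simp, key k i hm.2.symm he⟩
  have h1 := hm.1.disjoint
  have h2 := hm.2.disjoint
  have h3 := hm.3.disjoint
  rw [pathEdges_comm m] at h1 h2 h3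
  have hD : T.D {i, j, k} = T.pathWeight (T.leaf i) m + T.pathWeight (T.leaf j) m +
      T.pathWeight (T.leaf k) m := by
    simp only [pathWeight_eq_sum]
    rw [← Finset.sum_union h1, ← Finset.sum_union (Finset.disjoint_union_left.2 ⟨h2, h3⟩),
      ← hS]
    unfold D
    congr!
  rw [hD, hm.pathWeight_fst, hm.symm.pathWeight_fst, hm.rotate.pathWeight_fst,
    pathWeight_comm (T.leaf j) (T.leaf i), pathWeight_comm (T.leaf k) (T.leaf i),
    pathWeight_comm (T.leaf k) (T.leaf j)]
  ring

lemma exists_adj_ne {x : T.V} (hx : ¬ ∃ i, T.leaf i = x) (y : T.V) :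
    ∃ z, T.G.Adj x z ∧ z ≠ y := by
  rw [T.leaf_iff, not_le, ← SimpleGraph.card_neighborFinset_eq_degree] at hx
  obtain ⟨z, hz, hzy⟩ := Finset.exists_mem_ne hx y
  exact ⟨z, by simpa using hz, hzy⟩

/-- Every path can be prolonged to a leaf. -/
lemma exists_btw_leaf (hT : T.PosWeights) (u v : T.V) : ∃ i, T.Btw u v (T.leaf i) := by
  classical
  obtain ⟨x, hx, hmax⟩ := Finset.exists_max_image
    (Finset.univ.filter fun x => T.Btw u v x) (T.pathWeight u) ⟨v, by simp [Btw.right]⟩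
  simp only [Finset.mem_filter, Finset.mem_univ, true_and] at hx hmax
  by_contra! hne
  have hleaf : ¬ ∃ i, T.leaf i = x := by
    rintro ⟨i, rfl⟩
    exact hne i hx
  obtain ⟨z, hz, huz⟩ : ∃ z, T.G.Adj x z ∧ T.Btw u x z := by
    rcases eq_or_ne x u with rfl | hxu
    · obtain ⟨z, hz, -⟩ := exists_adj_ne hleaf x
      exact ⟨z, hz, Btw.left _ _⟩
    · obtain ⟨y, hy, hyu⟩ := Btw.exists_adj hxu
      obtain ⟨z, hz, hzy⟩ := exists_adj_ne hleaf y
      exact ⟨z, hz, Btw.of_adj_of_btw hT hy hz hzy.symm hyu (Btw.right _ _)⟩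
  have huvz : T.Btw u v z := (huz.symm.trans hx.symm).symm
  have h1 := hmax z huvz
  have h2 := huz.pathWeight_add
  have h3 := pathWeight_pos hT hz.ne
  linarith

/-- In a tree without vertices of degree two, every vertex is the median of three leaves. -/
lemma exists_isMedian_leaf (hT : T.PosWeights) (hdeg : ∀ v : T.V, T.G.degree v ≠ 2) (v : T.V) :
    ∃ i j k, IsMedian v (T.leaf i) (T.leaf j) (T.leaf k) := by
  by_cases hv : ∃ i, T.leaf i = v
  · obtain ⟨i, rfl⟩ := hv
    exact ⟨i, i, i, Btw.left _ _, Btw.left _ _, Btw.left _ _⟩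
  · rw [T.leaf_iff] at hv
    have h3 : 2 < (T.G.neighborFinset v).card := by
      have := hdeg v
      rw [SimpleGraph.card_neighborFinset_eq_degree]
      omega
    obtain ⟨a, b, c, ha, hb, hc, hab, hac, hbc⟩ := Finset.two_lt_card_iff.1 h3
    rw [SimpleGraph.mem_neighborFinset] at ha hb hc
    obtain ⟨i, hi⟩ := exists_btw_leaf hT v a
    obtain ⟨j, hj⟩ := exists_btw_leaf hT v b
    obtain ⟨k, hk⟩ := exists_btw_leaf hT v c
    exact ⟨i, j, k, Btw.of_adj_of_btw hT ha hb hab hi hj, Btw.of_adj_of_btw hT ha hc hac hi hk,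
      Btw.of_adj_of_btw hT hb hc hbc hj hk⟩

/-- `v` and `v'` have the same distances to the leaves of the respective trees. -/
def SameProfile {T T' : WeightedTree n} (v : T.V) (v' : T'.V) : Prop :=
  ∀ l, T.pathWeight v (T.leaf l) = T'.pathWeight v' (T'.leaf l)

lemma SameProfile.symm {T T' : WeightedTree n} {v : T.V} {v' : T'.V} (h : SameProfile v v') :
    SameProfile v' v := fun l => (h l).symm

lemma pathWeight_leaf_le_of_isMedian {T T' : WeightedTree n} (hT' : T'.PosWeights)
    (hd : ∀ i j, T.pathWeight (T.leaf i) (T.leaf j) = T'.pathWeight (T'.leaf i) (T'.leaf j))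
    {i j k : Fin n} {v : T.V} {v' : T'.V}
    (h : IsMedian v (T.leaf i) (T.leaf j) (T.leaf k))
    (h' : IsMedian v' (T'.leaf i) (T'.leaf j) (T'.leaf k)) (l : Fin n) :
    T.pathWeight v (T.leaf l) ≤ T'.pathWeight v' (T'.leaf l) := by
  have hi : T.pathWeight (T.leaf i) v = T'.pathWeight (T'.leaf i) v' := by
    rw [h.pathWeight_fst, h'.pathWeight_fst, hd, hd, hd]
  have hj : T.pathWeight (T.leaf j) v = T'.pathWeight (T'.leaf j) v' := by
    rw [h.symm.pathWeight_fst, h'.symm.pathWeight_fst, hd, hd, hd]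
  rcases h.btw_fst_snd.or (T.leaf l) with hl | hl
  · have h1 := hl.pathWeight_add
    have h2 := pathWeight_triangle hT' (T'.leaf i) v' (T'.leaf l)
    rw [hd, hi] at h1
    linarith
  · have h1 := hl.symm.pathWeight_add
    have h2 := pathWeight_triangle hT' (T'.leaf j) v' (T'.leaf l)
    rw [hd, hj] at h1
    linarith

section Compare

variable {T' : WeightedTree n} (hT : T.PosWeights) (hT' : T'.PosWeights)
  (hd : ∀ i j, T.pathWeight (T.leaf i) (T.leaf j) = T'.pathWeight (T'.leaf i) (T'.leaf j))
include hT hT'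

lemma SameProfile.pathWeight_le {u v : T.V} {u' v' : T'.V} (hu : SameProfile u u')
    (hv : SameProfile v v') : T.pathWeight u v ≤ T'.pathWeight u' v' := by
  obtain ⟨l, hl⟩ := exists_btw_leaf hT u v
  have h1 := hl.pathWeight_add
  have h2 := pathWeight_triangle hT' u' v' (T'.leaf l)
  rw [hu l, hv l] at h1
  linarith

lemma SameProfile.pathWeight_eq {u v : T.V} {u' v' : T'.V} (hu : SameProfile u u')
    (hv : SameProfile v v') : T.pathWeight u v = T'.pathWeight u' v' :=
  le_antisymm (hu.pathWeight_le hT hT' hv) (hu.symm.pathWeight_le hT' hT hv.symm)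

include hd

lemma exists_sameProfile (hdeg : ∀ v : T.V, T.G.degree v ≠ 2) (v : T.V) :
    ∃ v' : T'.V, SameProfile v v' := by
  obtain ⟨i, j, k, h⟩ := exists_isMedian_leaf hT hdeg v
  obtain ⟨v', h'⟩ := exists_isMedian hT' (T'.leaf i) (T'.leaf j) (T'.leaf k)
  exact ⟨v', fun l => le_antisymm (pathWeight_leaf_le_of_isMedian hT' hd h h' l)
    (pathWeight_leaf_le_of_isMedian hT (fun a b => (hd a b).symm) h' h l)⟩

/-- Trees without vertices of degree two are determined by the distances between leaves. -/
theorem weightedTreeIso_of_pathWeight_eq (hdeg : ∀ v : T.V, T.G.degree v ≠ 2)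
    (hdeg' : ∀ v : T'.V, T'.G.degree v ≠ 2) : WeightedTreeIso T T' := by
  choose f hf using exists_sameProfile hT hT' hd hdeg
  choose g hg using exists_sameProfile hT' hT (fun a b => (hd a b).symm) hdeg'
  have hgf : ∀ v, g (f v) = v := fun v => eq_of_pathWeight_eq_zero hT <| by
    rw [(hg (f v)).symm.pathWeight_eq hT hT' (hf v), pathWeight_self]
  have hfg : ∀ v, f (g v) = v := fun v => eq_of_pathWeight_eq_zero hT' <| by
    rw [(hf (g v)).symm.pathWeight_eq hT' hT (hg v), pathWeight_self]
  have hiso : ∀ u v, T'.pathWeight (f u) (f v) = T.pathWeight u v := fun u v =>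
    ((hf u).pathWeight_eq hT hT' (hf v)).symm
  let φ : T.V ≃ T'.V := ⟨f, g, hgf, hfg⟩
  have hadj : ∀ u v, T'.G.Adj (f u) (f v) ↔ T.G.Adj u v := fun u v => by
    have hsurj : Function.Surjective f := φ.surjective
    have hinj : Function.Injective f := φ.injective
    rw [adj_iff_forall_pathWeight hT, adj_iff_forall_pathWeight hT', hsurj.forall]
    simp only [hiso, hinj.eq_iff, ne_eq]
  refine ⟨⟨φ, hadj _ _⟩, ?_, fun i => ?_⟩
  · intro e he
    induction e with | _ u v
    rw [SimpleGraph.mem_edgeSet] at he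
    change T'.w s(f u, f v) = _
    rw [← pathWeight_of_adj he, ← pathWeight_of_adj ((hadj u v).2 he), hiso]
  · have hleaf : SameProfile (T.leaf i) (T'.leaf i) := hd i
    refine eq_of_pathWeight_eq_zero hT' ?_
    change T'.pathWeight (f (T.leaf i)) (T'.leaf i) = 0
    rw [← (hf (T.leaf i)).pathWeight_eq hT hT' hleaf, pathWeight_self]

end Compare

/-- On at least five points, a function of pairs is determined by its sums over
triples. -/
lemma eq_of_triple_sum_eq (hn : 5 ≤ n) {f g : Fin n → Fin n → ℝ}
    (h : ∀ i j k : Fin n, i ≠ j → i ≠ k → j ≠ k →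
      f i j + f i k + f j k = g i j + g i k + g j k) {a b : Fin n} (hab : a ≠ b) :
    f a b = g a b := by
  have hcard : 2 < (({a, b} : Finset (Fin n))ᶜ).card := by
    rw [Finset.card_compl, Finset.card_pair hab, Fintype.card_fin]
    omega
  obtain ⟨c, d, e, hc, hd, he, hcd, hce, hde⟩ := Finset.two_lt_card_iff.1 hcard
  simp only [Finset.mem_compl, Finset.mem_insert, Finset.mem_singleton, not_or] at hc hd he
  linarith [h a b c hab (Ne.symm hc.1) (Ne.symm hc.2), h a b d hab (Ne.symm hd.1) (Ne.symm hd.2),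
    h a b e hab (Ne.symm he.1) (Ne.symm he.2), h a c d (Ne.symm hc.1) (Ne.symm hd.1) hcd,
    h a c e (Ne.symm hc.1) (Ne.symm he.1) hce, h a d e (Ne.symm hd.1) (Ne.symm he.1) hde,
    h b c d (Ne.symm hc.2) (Ne.symm hd.2) hcd, h b c e (Ne.symm hc.2) (Ne.symm he.2) hce,
    h b d e (Ne.symm hd.2) (Ne.symm he.2) hde, h c d e hcd hce hde]

end WeightedTree

/-- for `n ≥ 5`, two positive-weighted trees with leaf set `[n]`,
no vertices of degree 2 and the same triple weights are isomorphic as weighted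
trees. -/
theorem tree_determined_by_triple_weights (n : ℕ) (hn : 5 ≤ n)
    (T T' : WeightedTree n) (hpos : T.PosWeights) (hpos' : T'.PosWeights)
    (hdeg : ∀ v : T.V, T.G.degree v ≠ 2) (hdeg' : ∀ v : T'.V, T'.G.degree v ≠ 2)
    (hD : ∀ i j k : Fin n, i ≠ j → i ≠ k → j ≠ k →
      T.D {i, j, k} = T'.D {i, j, k}) :
    WeightedTreeIso T T' := by
  refine weightedTreeIso_of_pathWeight_eq hpos hpos' (fun a b => ?_) hdeg hdeg'
  rcases eq_or_ne a b with rfl | hab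
  · rw [pathWeight_self, pathWeight_self]
  · refine eq_of_triple_sum_eq hn (f := fun i j => T.pathWeight (T.leaf i) (T.leaf j))
      (g := fun i j => T'.pathWeight (T'.leaf i) (T'.leaf j))
      (fun i j k hij hik hjk => ?_) hab
    have h := hD i j k hij hik hjk
    rw [D_triple hpos, D_triple hpos'] at h
    linarith
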